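/- Let A be an m×m matrix over a commutative ring and x a scalar. Then: (i) det(x·J_{m×m} + A) = det(A) − x·det(overline{A}); (ii) det(overline{x·J_{m×m} + A}) = det(overline{A}); (iii) det(overline{−A}) = (−1)^{m+1} det(overline{A}). -/

import Mathlib

/-- The bordered matrix `overline{A}`: the `(m+1) × (m+1)` matrix whose upper-left
`m × m` block is `A`, whose last row and last column have all entries `1`, except
that the bottom-right corner entry is `0`. -/
def border {R : Type*} [Zero R] [One R] {m : ℕ} (A : Matrix (Fin m) (Fin m) R) :
    Matrix (Fin (m + 1)) (Fin (m + 1)) R :=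
  Matrix.of fun i j =>
    if hi : (i : ℕ) < m then
      if hj : (j : ℕ) < m then A ⟨i, hi⟩ ⟨j, hj⟩ else 1
    else if (j : ℕ) < m then 1 else 0

/-- The `m × m` all-ones matrix `J_{m×m}`. -/
def allOnes (R : Type*) [One R] (m : ℕ) : Matrix (Fin m) (Fin m) R :=
  Matrix.of fun _ _ => 1

open Matrix in
lemma border_det_blocks {R : Type*} [CommRing R] {m : ℕ} (A : Matrix (Fin m) (Fin m) R) :
    (border A).det = (fromBlocks A (of fun _ _ => 1) (of fun _ _ => 1)
      (0 : Matrix (Fin 1) (Fin 1) R)).det := by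
  rw [← det_submatrix_equiv_self (finSumFinEquiv (m := m) (n := 1)) (border A)]
  congr 1
  ext i j
  rcases i with i | i <;> rcases j with j | j <;> simp [border]

theorem det_add_allOnes_and_border {R : Type*} [CommRing R] {m : ℕ}
    (A : Matrix (Fin m) (Fin m) R) (x : R) :
    (x • allOnes R m + A).det = A.det - x * (border A).det ∧
    (border (x • allOnes R m + A)).det = (border A).det ∧
    (border (-A)).det = (-1) ^ (m + 1) * (border A).det := by
  have e2 : (border (x • allOnes R m + A)).det = (border A).det := by
    rw [border_det_blocks, border_det_blocks]
    have : Matrix.fromBlocks (x • allOnes R m + A) (Matrix.of fun _ _ => 1) (Matrix.of fun _ _ => 1)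
        (0 : Matrix (Fin 1) (Fin 1) R) =
        Matrix.fromBlocks 1 (Matrix.of fun _ _ => x) 0 1 *
        Matrix.fromBlocks A (Matrix.of fun _ _ => 1) (Matrix.of fun _ _ => 1)
        (0 : Matrix (Fin 1) (Fin 1) R) := by
      rw [Matrix.fromBlocks_multiply]
      ext i j
      rcases i with i | i <;> rcases j with j | j <;> simp [allOnes, Matrix.mul_apply, add_comm]
    rw [this, Matrix.det_mul, Matrix.det_fromBlocks_zero₂₁]
    simp
  refine ⟨?_, e2, ?_⟩
  · rw [border_det_blocks]
    set B := Matrix.fromBlocks A (Matrix.of fun _ _ => 1) (Matrix.of fun _ _ => 1)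
        (0 : Matrix (Fin 1) (Fin 1) R) with hB
    have h1 : (Matrix.fromBlocks A (Matrix.of fun _ _ => -x) (Matrix.of fun _ _ => 1)
        (1 : Matrix (Fin 1) (Fin 1) R)).det = (x • allOnes R m + A).det := by
      rw [Matrix.det_fromBlocks_one₂₂]
      congr 1
      ext i j
      simp [allOnes, Matrix.mul_apply, add_comm]
    have h2 : Matrix.fromBlocks A (Matrix.of fun _ _ => -x) (Matrix.of fun _ _ => 1)
        (1 : Matrix (Fin 1) (Fin 1) R) = B.updateCol (Sum.inr 0)
          (Sum.elim (fun _ => 0) (fun _ => 1) + (-x) • (fun i => B i (Sum.inr 0))) := by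
      ext i j
      rcases i with i | i <;> rcases j with j | j <;>
        simp [hB, Matrix.updateCol_apply, Subsingleton.elim _ (0 : Fin 1)]
    have h3 : B.updateCol (Sum.inr 0) (Sum.elim (fun _ => 0) (fun _ => 1)) =
        Matrix.fromBlocks A 0 (Matrix.of fun _ _ => 1) (1 : Matrix (Fin 1) (Fin 1) R) := by
      ext i j
      rcases i with i | i <;> rcases j with j | j <;>
        simp [hB, Matrix.updateCol_apply, Subsingleton.elim _ (0 : Fin 1)]
    have h4 : B.updateCol (Sum.inr 0) (fun i => B i (Sum.inr 0)) = B := by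
      ext i j
      by_cases h : j = Sum.inr 0 <;> simp [h, Matrix.updateCol_apply]
    rw [← h1, h2, Matrix.det_updateCol_add, Matrix.det_updateCol_smul, h3, h4,
      Matrix.det_fromBlocks_zero₁₂]
    simp
    ring
  · rw [border_det_blocks, border_det_blocks]
    have : Matrix.fromBlocks (-A) (Matrix.of fun _ _ => 1) (Matrix.of fun _ _ => 1)
        (0 : Matrix (Fin 1) (Fin 1) R) =
        -(Matrix.fromBlocks 1 0 0 (-1) *
        Matrix.fromBlocks A (Matrix.of fun _ _ => 1) (Matrix.of fun _ _ => 1)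
        (0 : Matrix (Fin 1) (Fin 1) R) * Matrix.fromBlocks 1 0 0 (-1)) := by
      rw [Matrix.fromBlocks_multiply, Matrix.fromBlocks_multiply]
      ext i j
      rcases i with i | i <;> rcases j with j | j <;> simp
    rw [this, Matrix.det_neg, Matrix.det_mul, Matrix.det_mul, Matrix.det_fromBlocks_zero₂₁]
    simp [Matrix.det_neg]
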